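/- arXiv:0811.3833 — 2 statements merged into one kernel-verified Lean document; each statement's English description precedes it below -/
import Mathlib

section
/- Let K be a field, (L,ρ) a partial character on ℤ^m with L nonzero and positive. For every face F of σ_L = pos_ℚ(A), the ideal I_{L_F,ρ} = I_{L,ρ} ∩ K[𝔼_F] coincides with the lattice ideal I_{L∩ℤ^{𝔼_F},ρ} of the sublattice L ∩ ℤ^{𝔼_F} with the restricted character. -/
open MvPolynomial

namespace LatticePaper

variable {m n : ℕ}

/-- The positive part `u₊` of an integer vector, as an exponent vector. -/
noncomputable def pp (u : Fin m → ℤ) : Fin m →₀ ℕ :=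
  Finsupp.equivFunOnFinite.symm fun i => (u i).toNat

/-- The negative part `u₋` of an integer vector, as an exponent vector. -/
noncomputable def np (u : Fin m → ℤ) : Fin m →₀ ℕ :=
  Finsupp.equivFunOnFinite.symm fun i => (-u i).toNat

/-- The positive part `u₊` as an integer vector. -/
def ppz (u : Fin m → ℤ) : Fin m → ℤ := fun i => max (u i) 0

/-- The negative part `u₋` as an integer vector. -/
def npz (u : Fin m → ℤ) : Fin m → ℤ := fun i => max (-u i) 0

/-- `ℤ^E`, the subgroup of vectors supported on `E`. -/
def ZE (E : Set (Fin m)) : AddSubgroup (Fin m → ℤ) where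
  carrier := {u | ∀ i, i ∉ E → u i = 0}
  add_mem' := by intro a b ha hb i hi; simp [ha i hi, hb i hi]
  zero_mem' := by intro i _; rfl
  neg_mem' := by intro a ha i hi; simp [ha i hi]

/-- `L` is a positive lattice: `L ∩ ℕ^m = {0}`. -/
def IsPositive (L : AddSubgroup (Fin m → ℤ)) : Prop :=
  ∀ u ∈ L, (∀ i, 0 ≤ u i) → u = 0

/-- The binomial `B(u) = x^{u₊} - ρ(u) x^{u₋}` attached to a partial character `ρ` on `L`. -/
noncomputable def Bpoly (K : Type*) [Field K] {L : AddSubgroup (Fin m → ℤ)}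
    (ρ : AddChar L Kˣ) (u : L) : MvPolynomial (Fin m) K :=
  monomial (pp (u : Fin m → ℤ)) (1 : K) - monomial (np (u : Fin m → ℤ)) ((ρ u : Kˣ) : K)

/-- The ideal generated by the binomials `B(u)` for `u ∈ L` with `u ∈ S`. -/
noncomputable def latIdealOn (K : Type*) [Field K] {L : AddSubgroup (Fin m → ℤ)}
    (ρ : AddChar L Kˣ) (S : Set (Fin m → ℤ)) : Ideal (MvPolynomial (Fin m) K) :=
  Ideal.span {f | ∃ u : L, (u : Fin m → ℤ) ∈ S ∧ f = Bpoly K ρ u}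

/-- The lattice ideal `I_{L,ρ}`. -/
noncomputable def latIdeal (K : Type*) [Field K] {L : AddSubgroup (Fin m → ℤ)}
    (ρ : AddChar L Kˣ) : Ideal (MvPolynomial (Fin m) K) :=
  latIdealOn K ρ Set.univ

/-- The configuration vectors, regarded over `ℚ`. -/
def ratA (A : Fin m → Fin n → ℤ) : Fin m → Fin n → ℚ := fun i j => (A i j : ℚ)

/-- The rational polyhedral cone `pos_ℚ(A)`. -/
def cone (A : Fin m → Fin n → ℤ) : Set (Fin n → ℚ) :=
  {x | ∃ lam : Fin m → ℚ, (∀ i, 0 ≤ lam i) ∧ x = ∑ i, lam i • ratA A i}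

/-- `F` is a face of the cone `pos_ℚ(A)`. -/
def IsFace (A : Fin m → Fin n → ℤ) (F : Set (Fin n → ℚ)) : Prop :=
  ∃ c : Fin n → ℚ, (∀ x ∈ cone A, 0 ≤ ∑ j, c j * x j) ∧
    F = cone A ∩ {x | ∑ j, c j * x j = 0}

/-- `𝔼_F = {i | a_i ∈ F}`. -/
def EF (A : Fin m → Fin n → ℤ) (F : Set (Fin n → ℚ)) : Set (Fin m) :=
  {i | ratA A i ∈ F}

/-- `A` is the configuration of vectors associated to the lattice `L`:
the `A`-degree map `ℤ^m → ℤ^n` is surjective with kernel `Sat(L)`. -/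
def IsConfig (L : AddSubgroup (Fin m → ℤ)) (A : Fin m → Fin n → ℤ) : Prop :=
  (∀ u : Fin m → ℤ, (∑ i, u i • A i) = 0 ↔ ∃ d : ℤ, d ≠ 0 ∧ d • u ∈ L) ∧
  Function.Surjective fun u : Fin m → ℤ => ∑ i, u i • A i

/-- A polynomial is `A`-homogeneous if all its monomials have the same `A`-degree. -/
def AHomog {K : Type*} [Field K] (A : Fin m → Fin n → ℤ) (f : MvPolynomial (Fin m) K) : Prop :=
  ∀ d ∈ f.support, ∀ e ∈ f.support, (∑ i, (d i : ℤ) • A i) = ∑ i, (e i : ℤ) • A i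

/-- The family of binomials `B(u i)` is a cover of `A`. -/
def IsCover {q : ℕ} (A : Fin m → Fin n → ℤ) (u : Fin q → Fin m → ℤ) : Prop :=
  ∀ E : Set (Fin m), (∀ F : Set (Fin n → ℚ), IsFace A F → E ≠ EF A F) →
    ∃ i, (ppz (u i) ∈ ZE E ∧ npz (u i) ∉ ZE E) ∨ (npz (u i) ∈ ZE E ∧ ppz (u i) ∉ ZE E)

/-- The minimal number of generators of an ideal. -/
noncomputable def mu {R : Type*} [CommRing R] (I : Ideal R) : ℕ :=
  sInf {s : ℕ | ∃ f : Fin s → R, Ideal.span (Set.range f) = I}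

/-- The arithmetical rank of an ideal. -/
noncomputable def ara {R : Type*} [CommRing R] (I : Ideal R) : ℕ :=
  sInf {s : ℕ | ∃ f : Fin s → R, (∀ i, f i ∈ I) ∧
    Ideal.radical (Ideal.span (Set.range f)) = Ideal.radical I}

/-- A binomial: a sum of (at most) two monomials. -/
def IsBinomial {K : Type*} [Field K] (f : MvPolynomial (Fin m) K) : Prop :=
  ∃ (a b : Fin m →₀ ℕ) (c d : K), f = monomial a c + monomial b d

/-- The binomial arithmetical rank of an ideal of a polynomial ring. -/
noncomputable def bar {K : Type*} [Field K] (I : Ideal (MvPolynomial (Fin m) K)) : ℕ :=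
  sInf {s : ℕ | ∃ f : Fin s → MvPolynomial (Fin m) K,
    (∀ i, f i ∈ I ∧ IsBinomial (f i)) ∧
    Ideal.radical (Ideal.span (Set.range f)) = Ideal.radical I}

/-- The rank of a sublattice of `ℤ^m`. -/
noncomputable def latRank (L : AddSubgroup (Fin m → ℤ)) : ℕ :=
  Module.finrank ℤ ↥(AddSubgroup.toIntSubmodule L)

/-- The toric ideal of a configuration `A` (trivial character). -/
noncomputable def toricIdeal (K : Type*) [Field K] (A : Fin m → Fin n → ℤ) :
    Ideal (MvPolynomial (Fin m) K) :=
  Ideal.span {f | ∃ u : Fin m → ℤ, (∑ i, u i • A i) = 0 ∧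
    f = monomial (pp u) (1 : K) - monomial (np u) 1}

/-- The lattice ideal of `L` with trivial character. -/
noncomputable def latIdeal1 (K : Type*) [Field K] (L : AddSubgroup (Fin m → ℤ)) :
    Ideal (MvPolynomial (Fin m) K) :=
  Ideal.span {f | ∃ u ∈ L, f = monomial (pp u) (1 : K) - monomial (np u) 1}

/-- A full configuration of vectors: `pos_ℚ(A)` is an `n`-dimensional simplex cone generated
by the first `n` vectors, and the remaining vectors lie in its relative interior. -/
def IsFull (hnm : n ≤ m) (A : Fin m → Fin n → ℤ) : Prop :=
  LinearIndependent ℚ (fun i : Fin n => ratA A (Fin.castLE hnm i)) ∧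
  cone A = cone (fun i : Fin n => A (Fin.castLE hnm i)) ∧
  ∀ i : Fin m, n ≤ (i : ℕ) → ∃ lam : Fin n → ℚ, (∀ k, 0 < lam k) ∧
    ratA A i = ∑ k, lam k • ratA A (Fin.castLE hnm k)

end LatticePaper

namespace LatticePaper

/-- The (3,3)-Veronese configuration. -/
def veroneseA : Fin 10 → Fin 3 → ℤ :=
  ![![3,0,0], ![0,3,0], ![0,0,3], ![2,1,0], ![1,2,0],
    ![0,2,1], ![0,1,2], ![2,0,1], ![1,0,2], ![1,1,1]]

def e1v (m q : ℕ) : Fin 4 → ℤ :=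
  ![(m : ℤ) + 2 * (q : ℤ) - 3, -(m : ℤ) + 2 * (q : ℤ) + 5, -1, -1]

def e2v (m q : ℕ) : Fin 4 → ℤ :=
  ![-(m : ℤ) - 2 * (q : ℤ) + 5, (m : ℤ) - 2 * (q : ℤ) - 3, -1, -1]

def e3v (m q : ℕ) : Fin 4 → ℤ :=
  ![-(m : ℤ) - 2 * (q : ℤ) + 5, -1, (m : ℤ) - 3, -1]

/-- The lattice `L(m)` of the examples. -/
def Lm (m q : ℕ) : AddSubgroup (Fin 4 → ℤ) :=
  AddSubgroup.closure {e1v m q, e2v m q, e3v m q}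

noncomputable def fpoly1 (K : Type*) [Field K] (m q : ℕ) : MvPolynomial (Fin 4) K :=
  X 0 ^ (m + 2 * q - 3) - X 1 ^ (m - 2 * q - 5) * X 2 * X 3

noncomputable def fpoly2 (K : Type*) [Field K] (m q : ℕ) : MvPolynomial (Fin 4) K :=
  X 1 ^ (m - 2 * q - 3) - X 0 ^ (m + 2 * q - 5) * X 2 * X 3

noncomputable def fpoly3 (K : Type*) [Field K] (m q : ℕ) : MvPolynomial (Fin 4) K :=
  X 2 ^ (m - 3) - X 0 ^ (m + 2 * q - 5) * X 1 * X 3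

noncomputable def fpoly123 (K : Type*) [Field K] (m : ℕ) : MvPolynomial (Fin 4) K :=
  if Even m then X 3 ^ (m - 3) - X 0 * X 1 ^ (m - 5) * X 2
  else X 3 ^ (m - 3) - X 0 ^ (m - 3) * X 1 * X 2

end LatticePaper

namespace LatticePaper

open Classical in
/-- The retraction `K[x] → K[E]` killing the variables outside `E`. -/
noncomputable def retr (K : Type*) [Field K] {m : ℕ} (E : Set (Fin m)) :
    MvPolynomial (Fin m) K →ₐ[K] ↥(MvPolynomial.supported K E) :=
  MvPolynomial.aeval fun i =>
    if h : i ∈ E then ⟨X i, Algebra.subset_adjoin ⟨i, h, rfl⟩⟩ else 0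

lemma retr_coe {K : Type*} [Field K] {m : ℕ} (E : Set (Fin m))
    (p : ↥(MvPolynomial.supported K E)) : retr K E (p : MvPolynomial (Fin m) K) = p := by
  apply Subtype.ext
  change ((MvPolynomial.supported K E).val.comp (retr K E)) (p : MvPolynomial (Fin m) K) = _
  have h : Set.EqOn ((MvPolynomial.supported K E).val.comp (retr K E))
      (AlgHom.id K (MvPolynomial (Fin m) K)) (MvPolynomial.supported K E) := by
    unfold MvPolynomial.supported
    intro x hx
    refine Algebra.adjoin_induction (p := fun x _ =>
      ((MvPolynomial.supported K E).val.comp (retr K E)) x =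
        (AlgHom.id K (MvPolynomial (Fin m) K)) x) ?_ ?_ ?_ ?_ hx
    · rintro _ ⟨i, hi, rfl⟩
      simp [retr, hi]
    · intro r; rw [AlgHom.commutes, AlgHom.commutes]
    · intro x y _ _ hx hy; rw [map_add, map_add, hx, hy]
    · intro x y _ _ hx hy; rw [map_mul, map_mul, hx, hy]
  exact h p.2

lemma retr_monomial_zero {K : Type*} [Field K] {m : ℕ} (E : Set (Fin m))
    (d : Fin m →₀ ℕ) (c : K) (i : Fin m) (hi : i ∉ E) (hd : d i ≠ 0) :
    retr K E (monomial d c) = 0 := by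
  unfold retr
  rw [aeval_monomial, Finsupp.prod, Finset.prod_eq_zero (i := i), mul_zero]
  · simpa using hd
  · simp [hi, hd]

lemma monomial_mem_supp {K : Type*} [Field K] {m : ℕ} (E : Set (Fin m))
    (d : Fin m →₀ ℕ) (c : K) (hd : ∀ i, i ∉ E → d i = 0) :
    monomial d c ∈ MvPolynomial.supported K E := by
  rw [mem_supported]
  intro i hi
  by_contra hE
  by_cases hc : c = 0
  · simp [hc] at hi
  · rw [vars_monomial hc] at hi
    have hi' : d i ≠ 0 := by simpa using hi
    exact hi' (hd i hE)

lemma Bpoly_mem_supp {K : Type*} [Field K] {m : ℕ} {L : AddSubgroup (Fin m → ℤ)}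
    (ρ : AddChar L Kˣ) (E : Set (Fin m)) (u : L) (hu : (u : Fin m → ℤ) ∈ ZE E) :
    Bpoly K ρ u ∈ MvPolynomial.supported K E := by
  have hu' : ∀ i, i ∉ E → (u : Fin m → ℤ) i = 0 := hu
  exact sub_mem (monomial_mem_supp _ _ _ fun i hi => by simp [pp, hu' i hi])
    (monomial_mem_supp _ _ _ fun i hi => by simp [np, hu' i hi])

/-- If `u ∈ Sat(L)` is not supported on `𝔼_F` it takes both signs outside `𝔼_F`. -/
lemma face_sign {m n : ℕ} (A : Fin m → Fin n → ℤ) (F : Set (Fin n → ℚ)) (hF : IsFace A F)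
    (u : Fin m → ℤ) (hu : (∑ i, u i • A i) = 0) (h : ∀ i, i ∉ EF A F → u i ≤ 0) :
    u ∈ ZE (EF A F) := by
  obtain ⟨c, hc, rfl⟩ := hF
  have hmem : ∀ i, ratA A i ∈ cone A := fun i =>
    ⟨Pi.single i 1, fun j => by
      by_cases hj : j = i
      · subst hj; simp
      · simp [hj], by
      rw [Finset.sum_eq_single i] <;> simp +contextual⟩
  set w : Fin m → ℚ := fun i => ∑ j, c j * ratA A i j with hw
  have hw0 : ∀ i, 0 ≤ w i := fun i => hc _ (hmem i)
  have hE : ∀ i, i ∈ EF A (cone A ∩ {x | ∑ j, c j * x j = 0}) ↔ w i = 0 := fun i =>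
    ⟨fun hi => hi.2, fun hi => ⟨hmem i, hi⟩⟩
  have hsum : ∑ i, (u i : ℚ) * w i = 0 := by
    have h1 : ∀ j, ∑ i, (u i : ℚ) * ratA A i j = 0 := fun j => by
      have := congrFun hu j
      simp only [Finset.sum_apply, Pi.smul_apply, smul_eq_mul, Pi.zero_apply] at this
      unfold ratA
      exact_mod_cast this
    calc ∑ i, (u i : ℚ) * w i = ∑ j, c j * ∑ i, (u i : ℚ) * ratA A i j := by
          simp only [hw, Finset.mul_sum]
          rw [Finset.sum_comm]
          exact Finset.sum_congr rfl fun j _ => Finset.sum_congr rfl fun i _ => by ring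
      _ = 0 := by simp [h1]
  have hle : ∀ i ∈ Finset.univ, (u i : ℚ) * w i ≤ 0 := fun i _ => by
    by_cases hi : i ∈ EF A (cone A ∩ {x | ∑ j, c j * x j = 0})
    · rw [(hE i).1 hi, mul_zero]
    · exact mul_nonpos_of_nonpos_of_nonneg (by exact_mod_cast h i hi) (hw0 i)
  have hz := (Finset.sum_eq_zero_iff_of_nonpos hle).1 hsum
  intro i hi
  rcases mul_eq_zero.1 (hz i (Finset.mem_univ i)) with h0 | h0
  · exact_mod_cast h0
  · exact absurd ((hE i).2 h0) hi

/-- for every face `F`, `I_{L,ρ} ∩ K[𝔼_F]` coincides with the lattice ideal of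
`L ∩ ℤ^{𝔼_F}` (with the restricted character) inside the subalgebra `K[𝔼_F]`. -/
theorem statement3 {K : Type*} [Field K] {m n : ℕ}
    (L : AddSubgroup (Fin m → ℤ)) (ρ : AddChar L Kˣ)
    (hL : L ≠ ⊥) (hpos : IsPositive L)
    (A : Fin m → Fin n → ℤ) (hA : IsConfig L A)
    (F : Set (Fin n → ℚ)) (hF : IsFace A F) :
    Ideal.comap (MvPolynomial.supported K (EF A F)).val (latIdeal K ρ) =
      Ideal.span {g : ↥(MvPolynomial.supported K (EF A F)) |
        ∃ u : L, (u : Fin m → ℤ) ∈ ZE (EF A F) ∧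
          (g : MvPolynomial (Fin m) K) = Bpoly K ρ u} := by
  apply le_antisymm
  · intro f hf
    have key : latIdeal K ρ ≤ Ideal.comap (retr K (EF A F))
        (Ideal.span {g : ↥(MvPolynomial.supported K (EF A F)) |
          ∃ u : L, (u : Fin m → ℤ) ∈ ZE (EF A F) ∧
            (g : MvPolynomial (Fin m) K) = Bpoly K ρ u}) := by
      unfold latIdeal latIdealOn
      rw [Ideal.span_le]
      rintro _ ⟨u, -, rfl⟩
      rw [SetLike.mem_coe, Ideal.mem_comap]
      by_cases hu : (u : Fin m → ℤ) ∈ ZE (EF A F)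
      · have := retr_coe (EF A F) ⟨Bpoly K ρ u, Bpoly_mem_supp ρ _ u hu⟩
        rw [this]
        exact Ideal.subset_span ⟨u, hu, rfl⟩
      · have hu0 : (∑ i, (u : Fin m → ℤ) i • A i) = 0 :=
          (hA.1 u).2 ⟨1, one_ne_zero, by simp⟩
        have h1 : ∃ i, i ∉ EF A F ∧ 0 < (u : Fin m → ℤ) i := by
          by_contra hcon
          push Not at hcon
          exact hu (face_sign A F hF u hu0 hcon)
        have h2 : ∃ i, i ∉ EF A F ∧ (u : Fin m → ℤ) i < 0 := by
          by_contra hcon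
          push Not at hcon
          refine hu (neg_mem_iff.1 (face_sign A F hF (-u) ?_ fun i hi => ?_))
          · simp only [Pi.neg_apply, neg_smul, Finset.sum_neg_distrib, hu0, neg_zero]
          · simpa using hcon i hi
        obtain ⟨i, hi, hi'⟩ := h1
        obtain ⟨j, hj, hj'⟩ := h2
        have : retr K (EF A F) (Bpoly K ρ u) = 0 := by
          unfold Bpoly
          rw [map_sub, retr_monomial_zero _ _ _ i hi, retr_monomial_zero _ _ _ j hj, sub_zero]
          · simpa [np] using hj'
          · simpa [pp] using hi'
        rw [this]
        exact Ideal.zero_mem _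
    have := key hf
    rw [Ideal.mem_comap] at this
    rwa [← retr_coe (EF A F) f]
  · rw [Ideal.span_le]
    rintro g ⟨u, -, hg⟩
    change (g : MvPolynomial (Fin m) K) ∈ latIdeal K ρ
    rw [hg]
    exact Ideal.subset_span ⟨u, trivial, rfl⟩

end LatticePaper
end

section
/- Let K be a field of characteristic p > 0, (L,ρ) a partial character on ℤ^m with L nonzero and positive, u₁,…,u_q elements of L, and σ_L = pos_ℚ(A) the rational polyhedral cone associated to I_{L,ρ}. Then rad(I_{L,ρ}) = rad(B(u₁),…,B(u_q)) if and only if (i) {B(u₁),…,B(u_q)} is a cover of A, and (ii) for every face F of σ_L the p-saturations agree: (L ∩ ℤ^{𝔼_F}) : p^∞ = (Σ_{u_i ∈ ℤ^{𝔼_F}} ℤu_i) : p^∞. -/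
open MvPolynomial

namespace LatticePaper

/-! ### Farkas' lemma over an ordered field -/

lemma farkas_fin {V : Type*} [AddCommGroup V] [Module ℚ V] (k : ℕ) :
    ∀ (f : Fin k → V →ₗ[ℚ] ℚ) (g : V →ₗ[ℚ] ℚ),
      (∀ x, (∀ i, 0 ≤ f i x) → 0 ≤ g x) →
      ∃ l : Fin k → ℚ, (∀ i, 0 ≤ l i) ∧ ∀ x, g x = ∑ i, l i * f i x := by
  induction k with
  | zero =>
    intro f g h
    refine ⟨fun _ => 0, fun _ => le_rfl, fun x => ?_⟩
    have h1 := h x (fun i => i.elim0)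
    have h2 := h (-x) (fun i => i.elim0)
    rw [map_neg] at h2
    simp
    linarith
  | succ k ih =>
    intro f g h
    by_cases hc : ∀ x, (∀ i : Fin k, 0 ≤ f i.succ x) → 0 ≤ g x
    · obtain ⟨l, hl, hg⟩ := ih (fun i => f i.succ) g hc
      refine ⟨Fin.cons 0 l, ?_, ?_⟩
      · intro i
        refine Fin.cases ?_ ?_ i
        · simp
        · intro j; simpa using hl j
      · intro x
        rw [hg x, Fin.sum_univ_succ]
        simp
    · push Not at hc
      obtain ⟨y, hy, hgy⟩ := hc
      have hfy : f 0 y < 0 := by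
        by_contra hcon
        push Not at hcon
        refine absurd (h y ?_) (not_le.mpr hgy)
        intro i
        exact Fin.cases hcon hy i
      obtain ⟨l, hl, hg⟩ := ih (fun i => f i.succ - (f i.succ y / f 0 y) • f 0)
        (g - (g y / f 0 y) • f 0) (by
          intro x hx
          have hz := h (x - (f 0 x / f 0 y) • y) (by
            intro i
            refine Fin.cases ?_ ?_ i
            · simp only [map_sub, map_smul, smul_eq_mul]
              rw [div_mul_cancel₀ _ hfy.ne]
              simp
            · intro j
              have := hx j
              simp only [LinearMap.sub_apply, LinearMap.smul_apply, smul_eq_mul, map_sub,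
                map_smul] at this ⊢
              convert this using 2
              field_simp)
          simp only [LinearMap.sub_apply, LinearMap.smul_apply, smul_eq_mul, map_sub,
                map_smul] at hz ⊢
          convert hz using 2
          field_simp)
      refine ⟨Fin.cons (g y / f 0 y - ∑ i, l i * (f i.succ y / f 0 y)) l, ?_, ?_⟩
      · intro i
        refine Fin.cases ?_ ?_ i
        · simp only [Fin.cons_zero]
          have h1 : 0 ≤ g y / f 0 y := div_nonneg_of_nonpos hgy.le hfy.le
          have h2 : ∑ i, l i * (f i.succ y / f 0 y) ≤ 0 :=
            Finset.sum_nonpos fun i _ =>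
              mul_nonpos_of_nonneg_of_nonpos (hl i) (div_nonpos_of_nonneg_of_nonpos (hy i) hfy.le)
          linarith
        · intro j; simpa using hl j
      · intro x
        have := hg x
        simp only [LinearMap.sub_apply, LinearMap.smul_apply, smul_eq_mul, mul_sub,
          Finset.sum_sub_distrib] at this
        rw [Fin.sum_univ_succ]
        simp only [Fin.cons_zero, Fin.cons_succ, sub_mul, Finset.sum_mul]
        have e : ∑ i, l i * (f i.succ y / f 0 y) * f 0 x
            = ∑ i, l i * (f i.succ y / f 0 y * f 0 x) :=
          Finset.sum_congr rfl fun i _ => by ring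
        rw [e]
        linarith

lemma clear_den (w : Fin m → ℚ) : ∃ (N : ℕ) (v : Fin m → ℤ), 0 < N ∧ ∀ i, (v i : ℚ) = N * w i := by
  have h : ∀ i, ∃ z : ℤ, (z : ℚ) = ((∏ i, (w i).den : ℕ) : ℚ) * w i := by
    intro i
    obtain ⟨k, hk⟩ := Finset.dvd_prod_of_mem (fun i => (w i).den) (Finset.mem_univ i)
    refine ⟨k * (w i).num, ?_⟩
    rw [hk]
    push_cast
    rw [← Rat.mul_den_eq_num (w i)]
    ring
  choose v hv using h
  exact ⟨_, v, Finset.prod_pos fun i _ => (w i).den_pos, hv⟩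

lemma ratA_mem_cone (A : Fin m → Fin n → ℤ) (i : Fin m) : ratA A i ∈ cone A := by
  classical
  refine ⟨Pi.single i 1, ?_, ?_⟩
  · intro j
    by_cases h : j = i
    · subst h; simp
    · simp [h]
  · simp [Pi.single_apply]

lemma mem_ZE {E : Set (Fin m)} {u : Fin m → ℤ} : u ∈ ZE E ↔ ∀ i, i ∉ E → u i = 0 := Iff.rfl

lemma rel_cast (A : Fin m → Fin n → ℤ) (v : Fin m → ℤ) :
    (∑ i, v i • A i) = 0 ↔ ∀ c : Fin n → ℚ, ∑ i, (v i : ℚ) * ∑ j, c j * ratA A i j = 0 := by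
  have key : ∀ c : Fin n → ℚ, ∑ i, (v i : ℚ) * ∑ j, c j * ratA A i j
      = ∑ j, c j * (((∑ i, v i • A i) j : ℤ) : ℚ) := by
    intro c
    simp only [Finset.mul_sum, Finset.sum_apply, Pi.smul_apply, smul_eq_mul, Int.cast_sum,
      Int.cast_mul, ratA]
    rw [Finset.sum_comm]
    refine Finset.sum_congr rfl fun j _ => Finset.sum_congr rfl fun i _ => by ring
  constructor
  · intro h c
    rw [key, h]
    simp
  · intro h
    funext j
    have := h (Pi.single j 1)
    rw [key] at this
    simp only [Pi.single_apply, ite_mul, one_mul, zero_mul, Finset.sum_ite_eq', Finset.mem_univ,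
      if_true] at this
    exact_mod_cast this

/-- If `E` is not the index set of a face, then some lattice vector separates. -/
lemma exists_of_not_face {L : AddSubgroup (Fin m → ℤ)} {A : Fin m → Fin n → ℤ}
    (hA : IsConfig L A) (E : Set (Fin m)) (hE : ∀ F, IsFace A F → E ≠ EF A F) :
    ∃ v ∈ L, npz v ∈ ZE E ∧ ppz v ∉ ZE E := by
  classical
  by_contra hcon
  push Not at hcon
  let D : Fin m → (Fin n → ℚ) →ₗ[ℚ] ℚ := fun i => ∑ j, (ratA A i j) • LinearMap.proj j
  have hD : ∀ i c, D i c = ∑ j, c j * ratA A i j := by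
    intro i c
    simp [D, mul_comm]
  have step : ∀ j, ∃ c : Fin n → ℚ, (∀ i, 0 ≤ D i c) ∧ (∀ i ∈ E, D i c = 0) ∧
      (j ∉ E → 0 < D j c) := by
    intro j
    by_cases hj : j ∈ E
    · exact ⟨0, by simp, by simp, fun h => absurd hj h⟩
    by_contra hno
    push Not at hno
    obtain ⟨l, hl, hg⟩ := farkas_fin (m + 1)
      (Fin.cons (-∑ i, if i ∈ E then D i else 0) D) (-(D j)) (by
        intro c hc
        have h0 := hc 0
        have hs : ∀ i, 0 ≤ D i c := fun i => by simpa using hc i.succ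
        have hz : ∀ i ∈ E, D i c = 0 := by
          have h1 : (∑ i, if i ∈ E then D i c else 0) ≤ 0 := by
            have : ((-∑ i, if i ∈ E then D i else 0) : (Fin n → ℚ) →ₗ[ℚ] ℚ) c
                = -∑ i, if i ∈ E then D i c else 0 := by
              rw [LinearMap.neg_apply, LinearMap.sum_apply]
              congr 1
              refine Finset.sum_congr rfl fun i _ => ?_
              split_ifs <;> simp
            rw [Fin.cons_zero, this] at h0
            linarith
          have h2 : ∀ i ∈ Finset.univ, 0 ≤ if i ∈ E then D i c else 0 := by
            intro i _
            split_ifs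
            · exact hs i
            · exact le_rfl
          have h3 := (Finset.sum_eq_zero_iff_of_nonneg h2).1 (le_antisymm h1 (Finset.sum_nonneg h2))
          intro i hi
          simpa [hi] using h3 i (Finset.mem_univ i)
        have := (hno c hs hz).2
        simpa using this)
    let w : Fin m → ℚ := fun i => l i.succ + (if i = j then 1 else 0) - (if i ∈ E then l 0 else 0)
    have hw : ∀ c, ∑ i, w i * D i c = 0 := by
      intro c
      have := hg c
      rw [Fin.sum_univ_succ] at this
      simp only [Fin.cons_zero, Fin.cons_succ, LinearMap.neg_apply, LinearMap.sum_apply] at this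
      simp only [w, sub_mul, add_mul, Finset.sum_sub_distrib, Finset.sum_add_distrib, ite_mul,
        one_mul, zero_mul, Finset.sum_ite_eq', Finset.mem_univ, if_true]
      have e : (∑ i, if i ∈ E then l 0 * D i c else 0)
          = l 0 * ∑ i, (if i ∈ E then D i else 0 : (Fin n → ℚ) →ₗ[ℚ] ℚ) c := by
        rw [Finset.mul_sum]
        refine Finset.sum_congr rfl fun i _ => ?_
        split_ifs <;> simp
      rw [e]
      linarith
    obtain ⟨N, v, hN, hv⟩ := clear_den w
    have hvrel : (∑ i, v i • A i) = 0 := by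
      rw [rel_cast]
      intro c
      have : ∑ i, (v i : ℚ) * ∑ j, c j * ratA A i j = N * ∑ i, w i * D i c := by
        rw [Finset.mul_sum]
        refine Finset.sum_congr rfl fun i _ => ?_
        rw [hv, hD]; ring
      rw [this, hw, mul_zero]
    obtain ⟨d, hd, hdv⟩ := (hA.1 v).1 hvrel
    have hdd : (d * d) • v ∈ L := by
      rw [mul_smul]; exact L.zsmul_mem hdv d
    have hd2 : 0 < d * d := mul_self_pos.2 hd
    have hNq : (0 : ℚ) < N := by exact_mod_cast hN
    have hpos : ∀ i, i ∉ E → 0 ≤ v i := by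
      intro i hi
      have : (0 : ℚ) ≤ v i := by
        rw [hv]
        have h1 := hl i.succ
        refine mul_nonneg hNq.le ?_
        simp only [w, hi, if_false, sub_zero]
        split_ifs <;> linarith
      exact_mod_cast this
    have hposj : 0 < v j := by
      have : (0 : ℚ) < v j := by
        rw [hv]
        have h1 := hl j.succ
        refine mul_pos hNq ?_
        simp only [w, hj, if_false, sub_zero, if_true]
        linarith
      exact_mod_cast this
    have := hcon _ hdd (by
      intro i hi
      have h1 := mul_nonneg hd2.le (hpos i hi)
      simp only [npz, Pi.smul_apply, smul_eq_mul]
      omega)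
    have h2 := this j hj
    have h3 := mul_pos hd2 hposj
    simp only [ppz, Pi.smul_apply, smul_eq_mul] at h2
    omega
  choose c hc0 hcE hcpos using step
  have hsum : ∀ i, D i (∑ j, c j) = ∑ j, D i (c j) := fun i => map_sum _ _ _
  refine hE (cone A ∩ {x | ∑ k, (∑ j, c j) k * x k = 0}) ⟨∑ j, c j, ?_, rfl⟩ ?_
  · rintro x ⟨lam, hlam, rfl⟩
    have : ∑ k, (∑ j, c j) k * (∑ i, lam i • ratA A i) k = ∑ i, lam i * D i (∑ j, c j) := by
      simp only [hD, Finset.sum_apply, Pi.smul_apply, smul_eq_mul, Finset.mul_sum]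
      rw [Finset.sum_comm]
      refine Finset.sum_congr rfl fun i _ => Finset.sum_congr rfl fun k _ => by ring
    rw [this]
    refine Finset.sum_nonneg fun i _ => mul_nonneg (hlam i) ?_
    rw [hsum]
    exact Finset.sum_nonneg fun j _ => hc0 j i
  · ext i
    have : i ∈ EF A (cone A ∩ {x | ∑ k, (∑ j, c j) k * x k = 0}) ↔ D i (∑ j, c j) = 0 := by
      rw [hD]
      exact ⟨fun h => h.2, fun h => ⟨ratA_mem_cone A i, h⟩⟩
    rw [this, hsum]
    constructor
    · intro hi
      exact Finset.sum_eq_zero fun j _ => hcE j i hi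
    · intro h
      by_contra hi
      have := (Finset.sum_eq_zero_iff_of_nonneg (fun j _ => hc0 j i)).1 h i (Finset.mem_univ i)
      exact (hcpos i hi).ne' this

/-- Lattice vectors do not separate faces. -/
lemma face_iff {A : Fin m → Fin n → ℤ} {F : Set (Fin n → ℚ)} (hF : IsFace A F)
    {v : Fin m → ℤ} (hv : (∑ i, v i • A i) = 0) :
    ppz v ∈ ZE (EF A F) ↔ npz v ∈ ZE (EF A F) := by
  obtain ⟨c, hc, rfl⟩ := hF
  have hmem : ∀ i, i ∈ EF A (cone A ∩ {x | ∑ k, c k * x k = 0}) ↔ ∑ k, c k * ratA A i k = 0 :=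
    fun i => ⟨fun h => h.2, fun h => ⟨ratA_mem_cone A i, h⟩⟩
  have hnn : ∀ i, 0 ≤ ∑ k, c k * ratA A i k := fun i => hc _ (ratA_mem_cone A i)
  have h0 := (rel_cast A v).1 hv c
  have hiff : ∀ w : Fin m → ℤ, (∀ i, 0 ≤ w i) →
      (w ∈ ZE (EF A (cone A ∩ {x | ∑ k, c k * x k = 0})) ↔
        ∑ i, (w i : ℚ) * ∑ k, c k * ratA A i k = 0) := by
    intro w hw
    rw [Finset.sum_eq_zero_iff_of_nonneg
      (fun i _ => mul_nonneg (by exact_mod_cast hw i) (hnn i)), mem_ZE]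
    refine forall_congr' fun i => ?_
    rw [hmem, mul_eq_zero]
    simp only [Finset.mem_univ, forall_true_left, Int.cast_eq_zero]
    tauto
  rw [hiff (ppz v) (fun i => le_max_right _ _), hiff (npz v) (fun i => le_max_right _ _)]
  have : ∑ i, (v i : ℚ) * ∑ k, c k * ratA A i k
      = ∑ i, (ppz v i : ℚ) * ∑ k, c k * ratA A i k
        - ∑ i, (npz v i : ℚ) * ∑ k, c k * ratA A i k := by
    rw [← Finset.sum_sub_distrib]
    refine Finset.sum_congr rfl fun i _ => ?_
    rw [← sub_mul]
    congr 1
    have : v i = ppz v i - npz v i := by simp only [ppz, npz]; omega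
    exact_mod_cast this
  rw [this] at h0
  constructor <;> intro h <;> linarith

lemma mem_ZE_iff {E : Set (Fin m)} {v : Fin m → ℤ} :
    v ∈ ZE E ↔ ppz v ∈ ZE E ∧ npz v ∈ ZE E := by
  simp only [mem_ZE, ppz, npz]
  constructor
  · intro h
    exact ⟨fun i hi => by rw [h i hi]; simp, fun i hi => by rw [h i hi]; simp⟩
  · rintro ⟨h1, h2⟩ i hi
    have := h1 i hi
    have := h2 i hi
    omega

/-! ### Evaluating binomials -/

section Eval

variable {K Ω : Type*} [Field K] [Field Ω] (φ : MvPolynomial (Fin m) K →+* Ω)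
  (E : Set (Fin m)) (y : Fin m → Ωˣ)

lemma eval_monomial (hE : ∀ i ∈ E, φ (X i) = y i) (d : Fin m →₀ ℕ) (k : K)
    (hd : ∀ i, i ∉ E → d i = 0) :
    φ (monomial d k) = φ (C k) * ((∏ i, y i ^ d i : Ωˣ) : Ω) := by
  rw [monomial_eq, map_mul, Finsupp.prod_fintype _ _ (by simp), map_prod]
  push_cast
  congr 1
  refine Finset.prod_congr rfl fun i _ => ?_
  rw [map_pow]
  by_cases hi : i ∈ E
  · rw [hE i hi]
  · simp [hd i hi]

lemma eval_monomial_zero (hE' : ∀ i, i ∉ E → φ (X i) = 0) (d : Fin m →₀ ℕ) (k : K)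
    (hd : ¬ ∀ i, i ∉ E → d i = 0) :
    φ (monomial d k) = 0 := by
  push Not at hd
  obtain ⟨i, hi, hdi⟩ := hd
  rw [monomial_eq, map_mul, Finsupp.prod_fintype _ _ (by simp), map_prod]
  rw [Finset.prod_eq_zero (Finset.mem_univ i), mul_zero]
  rw [map_pow, hE' i hi, zero_pow hdi]

lemma pp_supp (v : Fin m → ℤ) : (∀ i, i ∉ E → pp v i = 0) ↔ ppz v ∈ ZE E := by
  rw [mem_ZE]
  refine forall_congr' fun i => ?_
  simp only [pp, ppz, Finsupp.equivFunOnFinite_symm_apply_apply]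
  refine imp_congr_right fun _ => ?_
  omega

lemma np_supp (v : Fin m → ℤ) : (∀ i, i ∉ E → np v i = 0) ↔ npz v ∈ ZE E := by
  rw [mem_ZE]
  refine forall_congr' fun i => ?_
  simp only [np, npz, Finsupp.equivFunOnFinite_symm_apply_apply]
  refine imp_congr_right fun _ => ?_
  omega

variable {L : AddSubgroup (Fin m → ℤ)} (ρ : AddChar L Kˣ)

lemma eval_B_none (hE' : ∀ i, i ∉ E → φ (X i) = 0) (v : L)
    (h1 : ppz (v : Fin m → ℤ) ∉ ZE E) (h2 : npz (v : Fin m → ℤ) ∉ ZE E) :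
    φ (Bpoly K ρ v) = 0 := by
  rw [Bpoly, map_sub, eval_monomial_zero φ E hE' _ _ (by rwa [pp_supp]),
    eval_monomial_zero φ E hE' _ _ (by rwa [np_supp]), sub_zero]

lemma eval_B_left (hE : ∀ i ∈ E, φ (X i) = y i) (hE' : ∀ i, i ∉ E → φ (X i) = 0) (v : L)
    (h1 : ppz (v : Fin m → ℤ) ∈ ZE E) (h2 : npz (v : Fin m → ℤ) ∉ ZE E) :
    φ (Bpoly K ρ v) ≠ 0 := by
  rw [Bpoly, map_sub, eval_monomial φ E y hE _ _ (by rwa [pp_supp]),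
    eval_monomial_zero φ E hE' _ _ (by rwa [np_supp]), sub_zero]
  simp only [map_one, one_mul]
  exact Units.ne_zero _

lemma eval_B_right (hE : ∀ i ∈ E, φ (X i) = y i) (hE' : ∀ i, i ∉ E → φ (X i) = 0) (v : L)
    (h1 : ppz (v : Fin m → ℤ) ∉ ZE E) (h2 : npz (v : Fin m → ℤ) ∈ ZE E) :
    φ (Bpoly K ρ v) ≠ 0 := by
  rw [Bpoly, map_sub, eval_monomial_zero φ E hE' _ _ (by rwa [pp_supp]),
    eval_monomial φ E y hE _ _ (by rwa [np_supp]), zero_sub, neg_ne_zero]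
  refine mul_ne_zero ?_ (Units.ne_zero _)
  exact (map_ne_zero (φ.comp C)).2 (Units.ne_zero _)

lemma eval_B_both (hE : ∀ i ∈ E, φ (X i) = y i) (v : L)
    (h : (v : Fin m → ℤ) ∈ ZE E) :
    φ (Bpoly K ρ v) = 0 ↔
      ∏ i, y i ^ (v : Fin m → ℤ) i = Units.map (φ.comp C : K →* Ω) (ρ v) := by
  obtain ⟨h1, h2⟩ := mem_ZE_iff.1 h
  rw [Bpoly, map_sub, eval_monomial φ E y hE _ _ (by rwa [pp_supp]),
    eval_monomial φ E y hE _ _ (by rwa [np_supp]), sub_eq_zero]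
  have e : ∏ i, y i ^ (v : Fin m → ℤ) i
      = (∏ i, y i ^ pp (v : Fin m → ℤ) i) / (∏ i, y i ^ np (v : Fin m → ℤ) i) := by
    rw [← Finset.prod_div_distrib]
    refine Finset.prod_congr rfl fun i _ => ?_
    rw [← zpow_natCast, ← zpow_natCast, div_eq_mul_inv, ← zpow_sub]
    congr 1
    simp only [pp, np, Finsupp.equivFunOnFinite_symm_apply_apply]
    omega
  rw [e, div_eq_iff_eq_mul, Units.ext_iff]
  simp

end Eval

/-! ### Extending characters -/

lemma baer_units (Ω : Type*) [Field Ω] [IsAlgClosed Ω] : Module.Baer ℤ (Additive Ωˣ) := by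
  have key : ∀ n : ℕ, n ≠ 0 → ∀ a : Ωˣ, ∃ b : Ωˣ, b ^ n = a := by
    intro n hn a
    obtain ⟨z, hz⟩ := IsAlgClosed.exists_pow_nat_eq (a : Ω) (Nat.pos_of_ne_zero hn)
    have hz0 : z ≠ 0 := by
      rintro rfl
      rw [zero_pow hn] at hz
      exact a.ne_zero hz.symm
    exact ⟨Units.mk0 z hz0, Units.ext (by simpa using hz)⟩
  have : DivisibleBy (Additive Ωˣ) ℤ := divisibleByOfSMulRightSurj _ _ (by
    intro n hn a
    obtain ⟨b, hb⟩ := key n.natAbs (Int.natAbs_ne_zero.2 hn) (Additive.toMul a)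
    rcases Int.natAbs_eq n with h | h
    · refine ⟨Additive.ofMul b, ?_⟩
      simp only
      rw [h, natCast_zsmul, ← ofMul_pow, hb]
      rfl
    · refine ⟨-Additive.ofMul b, ?_⟩
      simp only
      rw [h, neg_smul_neg, natCast_zsmul, ← ofMul_pow, hb]
      rfl)
  exact Module.Baer.of_divisible _

lemma exists_root {Ω : Type*} [Field Ω] [IsAlgClosed Ω] {p : ℕ} [CharP Ω p] (hp : p.Prime)
    (N : ℕ) (hN : ∀ k, N ≠ p ^ k) : ∃ z : Ωˣ, z ≠ 1 ∧ z ^ N = 1 := by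
  have key : ∀ l : ℕ, l.Prime → l ≠ p → ∃ z : Ωˣ, z ≠ 1 ∧ z ^ l = 1 := by
    intro l hl hlp
    have : NeZero (l : Ω) := ⟨by
      intro h
      rw [CharP.cast_eq_zero_iff Ω p] at h
      exact hlp ((Nat.prime_dvd_prime_iff_eq hp hl).1 h).symm⟩
    obtain ⟨z, hz⟩ := HasEnoughRootsOfUnity.exists_primitiveRoot Ω l
    have hu := hz.isUnit hl.ne_zero
    refine ⟨hu.unit, ?_, ?_⟩
    · intro h
      have h1 : z = 1 := by simpa using congrArg (Units.val) h
      exact hz.ne_one hl.one_lt h1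
    · ext; simpa using hz.pow_eq_one
  by_cases h0 : N = 0
  · subst h0
    obtain ⟨l, hl1, hl⟩ := Nat.exists_infinite_primes (p + 1)
    obtain ⟨z, hz, -⟩ := key l hl (by omega)
    exact ⟨z, hz, pow_zero _⟩
  · have : ∃ l : ℕ, l.Prime ∧ l ∣ N ∧ l ≠ p := by
      by_contra hcon
      push Not at hcon
      exact hN _ (Nat.eq_prime_pow_of_unique_prime_dvd h0 (fun {d} hd hdN => hcon d hd hdN))
    obtain ⟨l, hl, ⟨t, rfl⟩, hlp⟩ := this
    obtain ⟨z, hz, hz1⟩ := key l hl hlp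
    exact ⟨z, hz, by rw [pow_mul, hz1, one_pow]⟩

lemma exists_theta {Ω : Type*} [Field Ω] [IsAlgClosed Ω] {p : ℕ} [CharP Ω p] (hp : p.Prime)
    (M : AddSubgroup (Fin m → ℤ)) (α : Fin m → ℤ) (h : ∀ k : ℕ, (p ^ k : ℤ) • α ∉ M) :
    ∃ θ : (Fin m → ℤ) →+ Additive Ωˣ, (∀ w ∈ M, θ w = 0) ∧ θ α ≠ 0 := by
  let a : (Fin m → ℤ) ⧸ M := QuotientAddGroup.mk α
  have hord : ∀ k, addOrderOf a ≠ p ^ k := by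
    intro k hk
    apply h k
    rw [← QuotientAddGroup.eq_zero_iff]
    have h1 := addOrderOf_nsmul_eq_zero a
    rw [hk] at h1
    rw [← h1]
    simp only [a]
    rw [← QuotientAddGroup.mk_nsmul]
    congr 1
  obtain ⟨z, hz, hzN⟩ := exists_root (Ω := Ω) hp _ hord
  let l : ℤ ⧸ Ideal.span {(addOrderOf a : ℤ)} →ₗ[ℤ] Additive Ωˣ :=
    Submodule.liftQSpanSingleton _ (LinearMap.toSpanSingleton ℤ _ (Additive.ofMul z)) (by
      rw [LinearMap.toSpanSingleton_apply, natCast_zsmul, ← ofMul_pow, hzN]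
      rfl)
  let g := l ∘ₗ (CharacterModule.intSpanEquivQuotAddOrderOf a).toLinearMap
  obtain ⟨t, ht⟩ := (baer_units Ω).extension_property (Submodule.span ℤ {a}).subtype
    (Submodule.subtype_injective _) g
  refine ⟨t.toAddMonoidHom.comp (QuotientAddGroup.mk' M), ?_, ?_⟩
  · intro w hw
    have : (QuotientAddGroup.mk' M) w = 0 := (QuotientAddGroup.eq_zero_iff w).2 hw
    rw [AddMonoidHom.comp_apply, this, map_zero]
  · have h1 := LinearMap.congr_fun ht ⟨a, Submodule.mem_span_singleton_self a⟩
    have h2 : g ⟨a, Submodule.mem_span_singleton_self a⟩ = Additive.ofMul z := by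
      simp only [g, LinearMap.comp_apply, LinearEquiv.coe_coe]
      rw [CharacterModule.intSpanEquivQuotAddOrderOf_apply_self]
      simp only [l, Submodule.liftQSpanSingleton_apply, LinearMap.toSpanSingleton_apply, one_smul]
    rw [h2] at h1
    intro h3
    apply hz
    have h4 : t a = 0 := h3
    have h5 : t a = Additive.ofMul z := h1
    rw [h4] at h5
    exact Additive.ofMul.injective (by rw [← h5]; rfl)

lemma exists_chi {K : Type*} [Field K] {L : AddSubgroup (Fin m → ℤ)} (ρ : AddChar L Kˣ)
    {Ω : Type*} [Field Ω] [IsAlgClosed Ω] (i : K →* Ω) :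
    ∃ χ : (Fin m → ℤ) →+ Additive Ωˣ, ∀ v : L, χ v = Additive.ofMul (Units.map i (ρ v)) := by
  let g : L →+ Additive Ωˣ :=
    { toFun := fun v => Additive.ofMul (Units.map i (ρ v))
      map_zero' := by simp
      map_add' := fun a b => by
        rw [AddChar.map_add_eq_mul, map_mul]; rfl }
  obtain ⟨t, ht⟩ := (baer_units Ω).extension_property_addMonoidHom L.subtype
    (Subtype.val_injective) g
  exact ⟨t, fun v => DFunLike.congr_fun ht v⟩

lemma prod_chi {Ω : Type*} [Field Ω] (χ : (Fin m → ℤ) →+ Additive Ωˣ) (v : Fin m → ℤ) :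
    ∏ i, (χ (Pi.single i 1)).toMul ^ v i = (χ v).toMul := by
  have h : v = ∑ i, v i • (Pi.single i (1 : ℤ) : Fin m → ℤ) := by
    funext j
    simp [Finset.sum_apply, Pi.single_apply]
  conv_rhs => rw [h, map_sum, toMul_sum]
  refine Finset.prod_congr rfl fun i _ => ?_
  rw [map_zsmul, toMul_zsmul]

/-- From equality of radicals: any point killing the `B(u i)` kills all `B(v)`. -/
lemma kills {K Ω : Type*} [Field K] [Field Ω] {L : AddSubgroup (Fin m → ℤ)} {ρ : AddChar L Kˣ}
    {q : ℕ} {u : Fin q → L}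
    (h : (latIdeal K ρ).radical = (Ideal.span (Set.range fun i => Bpoly K ρ (u i))).radical)
    (φ : MvPolynomial (Fin m) K →+* Ω) (hφ : ∀ i, φ (Bpoly K ρ (u i)) = 0) (v : L) :
    φ (Bpoly K ρ v) = 0 := by
  have h1 : Bpoly K ρ v ∈ (latIdeal K ρ).radical :=
    Ideal.le_radical (Ideal.subset_span ⟨v, Set.mem_univ _, rfl⟩)
  rw [h] at h1
  have hk : Ideal.span (Set.range fun i => Bpoly K ρ (u i)) ≤ RingHom.ker φ := by
    rw [Ideal.span_le]
    rintro _ ⟨i, rfl⟩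
    exact hφ i
  exact (RingHom.ker_isPrime φ).isRadical.radical_le_iff.2 hk h1

/-- Existence of points with prescribed support and character. -/
lemma exists_point {K Ω : Type*} [Field K] [Field Ω] [Algebra K Ω] (E : Set (Fin m))
    (χ : (Fin m → ℤ) →+ Additive Ωˣ) :
    ∃ φ : MvPolynomial (Fin m) K →+* Ω, (φ.comp C = algebraMap K Ω) ∧
      (∀ i ∈ E, φ (X i) = ((χ (Pi.single i 1)).toMul : Ωˣ)) ∧ (∀ i, i ∉ E → φ (X i) = 0) := by
  classical
  refine ⟨eval₂Hom (algebraMap K Ω)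
    (fun i => if i ∈ E then (((χ (Pi.single i 1)).toMul : Ωˣ) : Ω) else 0), ?_, ?_, ?_⟩
  · ext k; simp
  · intro i hi; simp [hi]
  · intro i hi; simp [hi]

lemma sub_direction {K : Type*} [Field K] {p : ℕ} [CharP K p] (hp : p.Prime)
    {L : AddSubgroup (Fin m → ℤ)} {ρ : AddChar L Kˣ}
    {A : Fin m → Fin n → ℤ} (hA : IsConfig L A) {q : ℕ} {u : Fin q → L}
    (hcov : IsCover A (fun i => (u i : Fin m → ℤ)))
    (hsat : ∀ F : Set (Fin n → ℚ), IsFace A F → ∀ α ∈ L ⊓ ZE (EF A F), ∃ k : ℕ,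
      (p ^ k : ℤ) • α ∈ AddSubgroup.closure
              {v : Fin m → ℤ | ∃ i, (u i : Fin m → ℤ) = v ∧ v ∈ ZE (EF A F)})
    {Ω : Type*} [Field Ω] (φ : MvPolynomial (Fin m) K →+* Ω)
    (hφ : ∀ i, φ (Bpoly K ρ (u i)) = 0) (v : L) : φ (Bpoly K ρ v) = 0 := by
  classical
  have : CharP Ω p := charP_of_injective_ringHom (φ.comp C).injective p
  let E : Set (Fin m) := {i | φ (X i) ≠ 0}
  let y : Fin m → Ωˣ := fun i => if h : φ (X i) ≠ 0 then Units.mk0 _ h else 1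
  have hE : ∀ i ∈ E, φ (X i) = y i := by
    intro i hi
    have hi' : φ (X i) ≠ 0 := hi
    simp only [y, dif_pos hi', Units.val_mk0]
  have hE' : ∀ i, i ∉ E → φ (X i) = 0 := by
    intro i hi
    simpa [E] using hi
  have hrel : ∀ w : L, (∑ i, (w : Fin m → ℤ) i • A i) = 0 := fun w =>
    (hA.1 w).2 ⟨1, one_ne_zero, by rw [one_smul]; exact w.2⟩
  by_cases hface : ∃ F, IsFace A F ∧ E = EF A F
  · obtain ⟨F, hF, hEF⟩ := hface
    have hiff := face_iff hF (hrel v)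
    rw [← hEF] at hiff
    by_cases h1 : ppz (v : Fin m → ℤ) ∈ ZE E
    · have hvE : (v : Fin m → ℤ) ∈ ZE E := mem_ZE_iff.2 ⟨h1, hiff.1 h1⟩
      rw [eval_B_both φ E y ρ hE v hvE]
      obtain ⟨k, hk⟩ := hsat F hF v ⟨v.2, by rw [← hEF]; exact hvE⟩
      have main : ∀ w ∈ AddSubgroup.closure
          {v : Fin m → ℤ | ∃ i, (u i : Fin m → ℤ) = v ∧ v ∈ ZE (EF A F)}, ∃ hw : w ∈ L,
          ∏ i, y i ^ w i = Units.map (φ.comp C : K →* Ω) (ρ ⟨w, hw⟩) := by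
        intro w hw
        induction hw using AddSubgroup.closure_induction with
        | mem w hw =>
          obtain ⟨i, rfl, hi⟩ := hw
          rw [← hEF] at hi
          exact ⟨(u i).2, (eval_B_both φ E y ρ hE (u i) hi).1 (hφ i)⟩
        | zero =>
          refine ⟨L.zero_mem, ?_⟩
          have : (⟨0, L.zero_mem⟩ : L) = 0 := rfl
          rw [this, AddChar.map_zero_eq_one]
          simp
        | add a b _ _ ha hb =>
          obtain ⟨ha1, ha2⟩ := ha
          obtain ⟨hb1, hb2⟩ := hb
          refine ⟨L.add_mem ha1 hb1, ?_⟩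
          have : (⟨a + b, L.add_mem ha1 hb1⟩ : L) = ⟨a, ha1⟩ + ⟨b, hb1⟩ := rfl
          rw [this, AddChar.map_add_eq_mul, map_mul, ← ha2, ← hb2, ← Finset.prod_mul_distrib]
          exact Finset.prod_congr rfl fun i _ => zpow_add _ _ _
        | neg a _ ha =>
          obtain ⟨ha1, ha2⟩ := ha
          refine ⟨L.neg_mem ha1, ?_⟩
          have : (⟨-a, L.neg_mem ha1⟩ : L) = -⟨a, ha1⟩ := rfl
          rw [this, AddChar.map_neg_eq_inv, map_inv, ← ha2, ← Finset.prod_inv_distrib]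
          exact Finset.prod_congr rfl fun i _ => zpow_neg _ _
      obtain ⟨hw, h2⟩ := main _ hk
      have e1 : (⟨(p ^ k : ℤ) • (v : Fin m → ℤ), hw⟩ : L) = (p ^ k) • v := by
        apply Subtype.ext
        rw [AddSubgroup.coe_nsmul, ← natCast_zsmul]
        push_cast
        rfl
      rw [e1, AddChar.map_nsmul_eq_pow, map_pow] at h2
      have e2 : ∏ i, y i ^ ((p ^ k : ℤ) • (v : Fin m → ℤ)) i
          = (∏ i, y i ^ (v : Fin m → ℤ) i) ^ (p ^ k) := by
        rw [← Finset.prod_pow]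
        refine Finset.prod_congr rfl fun i _ => ?_
        rw [Pi.smul_apply, smul_eq_mul, mul_comm, zpow_mul]
        exact_mod_cast rfl
      rw [e2] at h2
      have : Fact p.Prime := ⟨hp⟩
      have h3 := congrArg Units.val h2
      rw [Units.val_pow_eq_pow_val, Units.val_pow_eq_pow_val] at h3
      apply Units.ext
      exact iterateFrobenius_inj Ω p k (by simpa only [iterateFrobenius_def] using h3)
    · exact eval_B_none φ E ρ hE' v h1 (fun h => h1 (hiff.2 h))
  · exfalso
    push Not at hface
    obtain ⟨i, hi⟩ := hcov E hface
    rcases hi with ⟨h1, h2⟩ | ⟨h1, h2⟩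
    · exact eval_B_left φ E y ρ hE hE' (u i) h1 h2 (hφ i)
    · exact eval_B_right φ E y ρ hE hE' (u i) h2 h1 (hφ i)

/-- Theorem 3.5, characteristic `p > 0`: the binomials `B(u₁),…,B(u_q)` generate
`rad I_{L,ρ}` up to radical iff they form a cover of `A` and for every face `F` of `σ_L`
the `p`-saturation of the lattice generated by the `u_i` lying in `ℤ^{𝔼_F}` equals the
`p`-saturation of `L ∩ ℤ^{𝔼_F}`. -/
theorem statement5 {K : Type*} [Field K] {p : ℕ} [CharP K p] (hp : 0 < p) {m n : ℕ}
    (L : AddSubgroup (Fin m → ℤ)) (ρ : AddChar L Kˣ)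
    (hL : L ≠ ⊥) (hpos : IsPositive L)
    (A : Fin m → Fin n → ℤ) (hA : IsConfig L A)
    {q : ℕ} (u : Fin q → L) :
    (latIdeal K ρ).radical =
        (Ideal.span (Set.range fun i => Bpoly K ρ (u i))).radical ↔
      (IsCover A (fun i => (u i : Fin m → ℤ)) ∧
        ∀ F : Set (Fin n → ℚ), IsFace A F →
          {α : Fin m → ℤ | ∃ k : ℕ, (p ^ k : ℤ) • α ∈ L ⊓ ZE (EF A F)} =
          {α : Fin m → ℤ | ∃ k : ℕ, (p ^ k : ℤ) • α ∈
            AddSubgroup.closure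
              {v : Fin m → ℤ | ∃ i, (u i : Fin m → ℤ) = v ∧ v ∈ ZE (EF A F)}}) := by
  classical
  have hpp : p.Prime := (CharP.char_is_prime_or_zero K p).resolve_right hp.ne'
  have hrel : ∀ w : L, (∑ i, (w : Fin m → ℤ) i • A i) = 0 := fun w =>
    (hA.1 w).2 ⟨1, one_ne_zero, by rw [one_smul]; exact w.2⟩
  constructor
  · intro h
    refine ⟨?_, ?_⟩
    · intro E hE
      by_contra hno
      push Not at hno
      obtain ⟨v, hvL, hv1, hv2⟩ := exists_of_not_face hA E hE
      obtain ⟨χ, hχ⟩ := exists_chi ρ (algebraMap K (AlgebraicClosure K) : K →* AlgebraicClosure K)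
      obtain ⟨φ, hC, h1, h2⟩ := exists_point (K := K) E χ
      refine eval_B_right φ E _ ρ h1 h2 ⟨v, hvL⟩ hv2 hv1 (kills h φ ?_ _)
      intro i
      by_cases hi : ppz (u i : Fin m → ℤ) ∈ ZE E
      · have hi2 := (hno i).1 hi
        rw [eval_B_both φ E _ ρ h1 (u i) (mem_ZE_iff.2 ⟨hi, hi2⟩), prod_chi, hχ, hC]
        rfl
      · exact eval_B_none φ E ρ h2 _ hi (fun h => hi ((hno i).2 h))
    · intro F hF
      have hle : AddSubgroup.closure
              {v : Fin m → ℤ | ∃ i, (u i : Fin m → ℤ) = v ∧ v ∈ ZE (EF A F)}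
              ≤ L ⊓ ZE (EF A F) := by
        rw [AddSubgroup.closure_le]
        rintro _ ⟨i, rfl, hi⟩
        exact ⟨(u i).2, hi⟩
      apply Set.Subset.antisymm
      · rintro β ⟨k₀, hβL, hβE⟩
        set α := (p ^ k₀ : ℤ) • β with hα
        suffices hs : ∃ k : ℕ, (p ^ k : ℤ) • α ∈ AddSubgroup.closure
              {v : Fin m → ℤ | ∃ i, (u i : Fin m → ℤ) = v ∧ v ∈ ZE (EF A F)} by
          obtain ⟨k, hk⟩ := hs
          refine ⟨k + k₀, ?_⟩
          rw [pow_add, mul_smul]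
          exact hk
        by_contra hno
        push Not at hno
        have : CharP (AlgebraicClosure K) p :=
          charP_of_injective_algebraMap (algebraMap K (AlgebraicClosure K)).injective p
        obtain ⟨θ, hθ, hθα⟩ := exists_theta (Ω := AlgebraicClosure K) hpp _ α hno
        obtain ⟨χ, hχ⟩ :=
          exists_chi ρ (algebraMap K (AlgebraicClosure K) : K →* AlgebraicClosure K)
        obtain ⟨φ, hC, h1, h2⟩ := exists_point (K := K) (EF A F) (χ + θ)
        have hz := kills h φ (by
          intro i
          have hiff := face_iff hF (hrel (u i))
          by_cases hi : ppz (u i : Fin m → ℤ) ∈ ZE (EF A F)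
          · have hiE := mem_ZE_iff.2 ⟨hi, hiff.1 hi⟩
            rw [eval_B_both φ _ _ ρ h1 (u i) hiE, prod_chi, AddMonoidHom.add_apply, hχ, hC,
              hθ _ (AddSubgroup.subset_closure ⟨i, rfl, hiE⟩), add_zero]
            rfl
          · exact eval_B_none φ _ ρ h2 _ hi (fun h => hi (hiff.2 h))) ⟨α, hβL⟩
        rw [eval_B_both φ _ _ ρ h1 ⟨α, hβL⟩ hβE, prod_chi, AddMonoidHom.add_apply, hC] at hz
        have h3 := hχ ⟨α, hβL⟩
        simp only at h3 hz
        rw [h3] at hz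
        apply hθα
        have h4 := congrArg Additive.ofMul hz
        rw [ofMul_toMul] at h4
        exact add_eq_left.1 h4
      · rintro β ⟨k, hk⟩
        exact ⟨k, hle hk⟩
  · rintro ⟨hcov, hsat⟩
    apply le_antisymm
    · apply Ideal.radical_le_radical_iff.2
      rw [latIdeal, latIdealOn, Ideal.span_le]
      rintro _ ⟨v, -, rfl⟩
      rw [SetLike.mem_coe, Ideal.radical_eq_sInf, Submodule.mem_sInf]
      rintro P ⟨hJP, hP⟩
      let φ : MvPolynomial (Fin m) K →+* FractionRing (MvPolynomial (Fin m) K ⧸ P) :=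
        (algebraMap (MvPolynomial (Fin m) K ⧸ P) _).comp (Ideal.Quotient.mk P)
      have hφ : ∀ f, φ f = 0 ↔ f ∈ P := by
        intro f
        rw [← Ideal.Quotient.eq_zero_iff_mem]
        exact map_eq_zero_iff _ (IsFractionRing.injective (MvPolynomial (Fin m) K ⧸ P)
          (FractionRing (MvPolynomial (Fin m) K ⧸ P)))
      rw [← hφ]
      refine sub_direction hpp hA hcov ?_ φ (fun i => ?_) v
      · intro F hF α hα
        have : α ∈ {α : Fin m → ℤ | ∃ k : ℕ, (p ^ k : ℤ) • α ∈ L ⊓ ZE (EF A F)} :=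
          ⟨0, by simpa using hα⟩
        rw [hsat F hF] at this
        exact this
      · rw [hφ]
        exact hJP (Ideal.subset_span ⟨i, rfl⟩)
    · apply Ideal.radical_mono
      rw [Ideal.span_le]
      rintro _ ⟨i, rfl⟩
      exact Ideal.subset_span ⟨u i, Set.mem_univ _, rfl⟩

end LatticePaper
end
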